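/- arXiv:math/0301166 — 5 statements merged into one kernel-verified Lean document; each statement's English description precedes it below -/
import Mathlib

section
/- Sufficient criterion for good vector fields: Let f_1,…,f_q be germs at 0 of holomorphic functions ℂⁿ → ℂ vanishing at 0, let X = Σ_{i=1}^n X_i ∂/∂z_i be a germ of a holomorphic vector field at 0 tangent to f, i.e. there is a q×q matrix C = (c_{l,m}) of holomorphic germs with Σ_{i=1}^n (∂f_l/∂z_i)·X_i = Σ_{m=1}^q c_{l,m}·f_m as germs at 0 for every l = 1,…,q. Suppose every entry c_{l,m} lies in the ideal of the local ring 𝒪_{ℂⁿ,0} of holomorphic germs at 0 generated by all q×q minors of the Jacobian matrix (∂f_l/∂z_i). Then there exist functions X_{t,1},…,X_{t,n}, holomorphic in (z,t) near 0 ∈ ℂⁿ × ℂ^q, such that X_{t,i}(z,0) = X_i(z) for z near 0 and, for every l = 1,…,q, Σ_{i=1}^n (∂f_l/∂z_i)(z)·X_{t,i}(z,t) = Σ_{m=1}^q c_{l,m}(z)·(f_m(z) − t_m) for all (z,t) near 0; in particular, X is a good vector field (it admits a holomorphic deformation X_t which is tangent to every fibre V_t = f^{-1}(t) for t near 0). 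-/
open Filter Topology

/-- The partial derivative `∂g/∂z_i` of a function `g : ℂⁿ → ℂ` at a point `z`. -/
noncomputable def pd {n : ℕ} (i : Fin n) (g : (Fin n → ℂ) → ℂ) (z : Fin n → ℂ) : ℂ :=
  fderiv ℂ g z (Pi.single i 1)

theorem AnalyticAt.pd {n : ℕ} {g : (Fin n → ℂ) → ℂ} {z : Fin n → ℂ} (hg : AnalyticAt ℂ g z)
    (i : Fin n) : AnalyticAt ℂ (_root_.pd i g) z :=
  (ContinuousLinearMap.apply ℂ ℂ (Pi.single i 1 : Fin n → ℂ)).analyticAt _ |>.comp hg.fderiv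

theorem AnalyticAt.matrix_det {E ι : Type*} [NormedAddCommGroup E] [NormedSpace ℂ E] [Fintype ι]
    [DecidableEq ι] {M : E → Matrix ι ι ℂ} {z : E}
    (hM : ∀ i j, AnalyticAt ℂ (fun w => M w i j) z) :
    AnalyticAt ℂ (fun w => (M w).det) z := by
  simp only [Matrix.det_apply']
  exact Finset.analyticAt_fun_sum _ fun τ _ =>
    analyticAt_const.mul (Finset.analyticAt_fun_prod _ fun i _ => hM _ _)

theorem AnalyticAt.matrix_adjugate {E ι : Type*} [NormedAddCommGroup E] [NormedSpace ℂ E]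
    [Fintype ι] [DecidableEq ι] {M : E → Matrix ι ι ℂ} {z : E}
    (hM : ∀ i j, AnalyticAt ℂ (fun w => M w i j) z) (i j : ι) :
    AnalyticAt ℂ (fun w => (M w).adjugate i j) z := by
  simp only [Matrix.adjugate_apply]
  refine AnalyticAt.matrix_det fun k l => ?_
  by_cases h : k = j
  · subst h
    simpa using analyticAt_const
  · simpa [Matrix.updateRow_ne h] using hM k l

/-- Cramer's rule for a rectangular matrix: a multiple of a maximal minor times a standard basis
vector lies in the range of the matrix. -/
theorem Matrix.sum_mul_sum_ite_adjugate {R ι κ : Type*} [CommRing R] [Fintype ι] [DecidableEq ι]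
    [Fintype κ] [DecidableEq κ] (J : Matrix ι κ R) (σ : ι → κ) (k l : ι) :
    ∑ i, J k i * ∑ j, (if σ j = i then (J.submatrix id σ).adjugate j l else 0) =
      if k = l then (J.submatrix id σ).det else 0 := by
  have h := congrFun (congrFun (Matrix.mul_adjugate (J.submatrix id σ)) k) l
  simp only [Matrix.mul_apply, Matrix.submatrix_apply, id, Matrix.smul_apply, Matrix.one_apply,
    smul_eq_mul, mul_ite, mul_one, mul_zero] at h
  rw [← h]
  simp only [Finset.mul_sum, mul_ite, mul_zero]
  rw [Finset.sum_comm]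
  simp

/-- If each entry of a vector of germs is in the ideal of maximal minors of the Jacobian matrix,
then this vector is the image under the Jacobian matrix of a holomorphic vector field. -/
theorem exists_analyticAt_jacobian_mul_eq {n q : ℕ} {f : Fin q → (Fin n → ℂ) → ℂ}
    {b : Fin q → (Fin n → ℂ) → ℂ} (hf : ∀ l, AnalyticAt ℂ (f l) 0)
    (hb : ∀ l, ∃ a : (Fin q → Fin n) → (Fin n → ℂ) → ℂ,
      (∀ σ, AnalyticAt ℂ (a σ) 0) ∧
      ∀ᶠ z in 𝓝 (0 : Fin n → ℂ), b l z =
        ∑ σ : Fin q → Fin n, a σ z *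
          Matrix.det (Matrix.of fun l' j => pd (σ j) (f l') z : Matrix (Fin q) (Fin q) ℂ)) :
    ∃ W : Fin n → (Fin n → ℂ) → ℂ, (∀ i, AnalyticAt ℂ (W i) 0) ∧
      ∀ᶠ z in 𝓝 (0 : Fin n → ℂ), ∀ l, ∑ i, pd i (f l) z * W i z = b l z := by
  choose a ha hab using hb
  let J : (Fin n → ℂ) → Matrix (Fin q) (Fin n) ℂ := fun z => Matrix.of fun l i => pd i (f l) z
  refine ⟨fun i z => ∑ l, ∑ σ : Fin q → Fin n, a l σ z *
    ∑ j, (if σ j = i then ((J z).submatrix id σ).adjugate j l else 0), fun i => ?_, ?_⟩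
  · refine Finset.analyticAt_fun_sum _ fun l _ => Finset.analyticAt_fun_sum _ fun σ _ =>
      (ha l σ).mul (Finset.analyticAt_fun_sum _ fun j _ => ?_)
    split_ifs
    · exact AnalyticAt.matrix_adjugate (fun k m => (hf k).pd (σ m)) j l
    · exact analyticAt_const
  · filter_upwards [eventually_all.2 hab] with z hz k
    calc _ = ∑ l, ∑ σ : Fin q → Fin n, a l σ z * ∑ i, J z k i *
          ∑ j, (if σ j = i then ((J z).submatrix id σ).adjugate j l else 0) := by
          simp only [Finset.mul_sum (Finset.univ : Finset (Fin q)),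
            Finset.mul_sum (Finset.univ : Finset (Fin q → Fin n))]
          rw [Finset.sum_comm]
          refine Finset.sum_congr rfl fun l _ => ?_
          rw [Finset.sum_comm]
          refine Finset.sum_congr rfl fun σ _ => ?_
          rw [Finset.mul_sum]
          refine Finset.sum_congr rfl fun i _ => ?_
          rw [Finset.mul_sum]
          exact Finset.sum_congr rfl fun j _ => mul_left_comm _ _ _
      _ = b k z := by
          simp only [Matrix.sum_mul_sum_ite_adjugate, mul_ite, mul_zero]
          rw [Finset.sum_comm]
          simp only [Finset.sum_ite_eq, Finset.mem_univ, if_true]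
          exact (hz k).symm

/-- **Sufficient criterion for good vector fields.**
Let `f₁, …, f_q` be holomorphic germs at `0 ∈ ℂⁿ` vanishing at `0`, and let
`X = Σ Xᵢ ∂/∂zᵢ` be a holomorphic vector field tangent to `f`, i.e. `Xf = Cf` for a `q × q`
matrix `C = (c l m)` of holomorphic germs.  If every entry `c l m` lies in the ideal of the
local ring of germs generated by the `q × q` minors of the Jacobian matrix of `f` (expressed
here: `c l m` is, near `0`, a combination of the determinants
`det (∂f_l/∂z_{σ j})` over all choices `σ` of `q` columns, with holomorphic coefficients),
then `X` is good: there is a holomorphic deformation `Y = X_t` of `X`, holomorphic in `(z, t)`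
near `0 ∈ ℂⁿ × ℂ^q`, with `X_0 = X` and `Σᵢ (∂f_l/∂zᵢ) · X_{t,i} = Σₘ c l m · (f_m − t_m)`
near `0`; in particular `X_t` is tangent to every fibre `V_t = f⁻¹(t)` for `t` near `0`. -/
theorem good_vector_field_criterion (n q : ℕ)
    (f : Fin q → (Fin n → ℂ) → ℂ) (X : Fin n → (Fin n → ℂ) → ℂ)
    (c : Fin q → Fin q → (Fin n → ℂ) → ℂ)
    (hf : ∀ l, AnalyticAt ℂ (f l) 0) (hf0 : ∀ l, f l 0 = 0)
    (hX : ∀ i, AnalyticAt ℂ (X i) 0)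
    (hc : ∀ l m, AnalyticAt ℂ (c l m) 0)
    (htan : ∀ l, ∀ᶠ z in 𝓝 (0 : Fin n → ℂ),
      ∑ i, pd i (f l) z * X i z = ∑ m, c l m z * f m z)
    (hminor : ∀ l m, ∃ a : (Fin q → Fin n) → (Fin n → ℂ) → ℂ,
      (∀ σ, AnalyticAt ℂ (a σ) 0) ∧
      ∀ᶠ z in 𝓝 (0 : Fin n → ℂ), c l m z =
        ∑ σ : Fin q → Fin n, a σ z *
          Matrix.det (Matrix.of fun l' j => pd (σ j) (f l') z : Matrix (Fin q) (Fin q) ℂ)) :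
    ∃ Y : Fin n → ((Fin n → ℂ) × (Fin q → ℂ)) → ℂ,
      (∀ i, AnalyticAt ℂ (Y i) 0) ∧
      (∀ᶠ z in 𝓝 (0 : Fin n → ℂ), ∀ i, Y i (z, 0) = X i z) ∧
      (∀ l, ∀ᶠ zt in 𝓝 (0 : (Fin n → ℂ) × (Fin q → ℂ)),
        ∑ i, pd i (f l) zt.1 * Y i zt = ∑ m, c l m zt.1 * (f m zt.1 - zt.2 m)) := by
  choose W hW hWc using fun m => exists_analyticAt_jacobian_mul_eq hf fun l => hminor l m
  have hfst : Tendsto Prod.fst (𝓝 (0 : (Fin n → ℂ) × (Fin q → ℂ))) (𝓝 (0 : Fin n → ℂ)) :=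
    continuous_fst.tendsto _
  refine ⟨fun i zt => X i zt.1 - ∑ m, zt.2 m * W m i zt.1, fun i => ?_, by simp, fun l => ?_⟩
  · refine ((hX i).comp_of_eq analyticAt_fst rfl).sub (Finset.analyticAt_fun_sum _ fun m _ => ?_)
    exact (((ContinuousLinearMap.proj (R := ℂ) (φ := fun _ : Fin q => ℂ) m).analyticAt _).comp
      analyticAt_snd).mul ((hW m i).comp_of_eq analyticAt_fst rfl)
  · filter_upwards [hfst.eventually (htan l), hfst.eventually (eventually_all.2 hWc)]
      with zt hX hW
    simp only [mul_sub, Finset.sum_sub_distrib, hX, Finset.mul_sum]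
    rw [Finset.sum_comm]
    congr 1
    refine Finset.sum_congr rfl fun m _ => ?_
    rw [← hW m l, Finset.sum_mul]
    exact Finset.sum_congr rfl fun i _ => by ring
end

section
/- Nonzerodivisor criterion for the minor DF (core of Lemma 4.1(i)): Let R be a commutative ring and let X_1,…,X_n, m_1,…,m_n ∈ R satisfy the Cramer relations (−1)^i·m_i·X_1 = −m_1·X_i for all i = 1,…,n. Assume that X_1 is not a zero divisor in R and that the ideal of R generated by m_1,…,m_n contains an element that is not a zero divisor. Then m_1 is not a zero divisor in R. -/
/-- **Nonzerodivisor criterion for the minor `DF` (core of Lemma 4.1(i)).**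
Let `R` be a commutative ring and `X₁, …, Xₙ, m₁, …, mₙ ∈ R` satisfy the Cramer relations
`(−1)^i mᵢ X₁ = −m₁ Xᵢ` for all `i = 1, …, n` (in the `0`-based indexing used here this
reads `(−1)^(i+1) mᵢ X₀ = −(m₀ Xᵢ)`).  If `X₁` is not a zero divisor in `R` and the ideal
generated by `m₁, …, mₙ` contains an element that is not a zero divisor, then `m₁` is not a
zero divisor in `R`. -/
theorem nonzerodivisor_minor (R : Type*) [CommRing R] (n : ℕ) [NeZero n]
    (X m : Fin n → R)
    (hrel : ∀ i : Fin n, (-1 : R) ^ ((i : ℕ) + 1) * m i * X 0 = -(m 0 * X i))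
    (hX1 : X 0 ∈ nonZeroDivisors R)
    (hm : ∃ r ∈ Ideal.span (Set.range m), r ∈ nonZeroDivisors R) :
    m 0 ∈ nonZeroDivisors R := by
  obtain ⟨r, hr, hr0⟩ := hm
  rw [mem_nonZeroDivisors_iff_right]
  intro g hg
  have hgm : ∀ i, g * m i = 0 := fun i => by
    have h : g * m i * (-1 : R) ^ ((i : ℕ) + 1) * X 0 = 0 := by
      linear_combination g * hrel i - X i * hg
    have h' := (mul_right_mem_nonZeroDivisors_eq_zero_iff hX1).mp h
    rcases neg_one_pow_eq_or R ((i : ℕ) + 1) with hs | hs <;> simpa [hs] using h'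
  have hspan : Ideal.span (Set.range m) ≤ LinearMap.ker (LinearMap.mulLeft R g) := by
    rw [Ideal.span_le]
    rintro _ ⟨i, rfl⟩
    exact hgm i
  exact (mul_right_mem_nonZeroDivisors_eq_zero_iff hr0).mp (hspan hr)
end

section
/- Annihilator computation for plane curves (Section 5.3): Let R be a commutative ring and γ, δ_1, δ_2, f, f_1, f_2 ∈ R. Define X_1 := γ·f_2 + δ_1·f, X_2 := −γ·f_1 + δ_2·f, and c := δ_1·f_1 + δ_2·f_2. Assume that (X_1, X_2) is a regular sequence in R (i.e. X_1 is not a zero divisor in R and X_2 is not a zero divisor in R/(X_1)) and that f_2 is not a zero divisor in R/(f). Then for every g ∈ R one has c·g ∈ (X_1, X_2) if and only if g ∈ (γ, f) + (X_1, X_2); equivalently, the annihilator of the class of c in the quotient ring 𝔹 = R/(X_1, X_2) is the ideal of 𝔹 generated by the classes of γ and f. -/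
/-- If `x` is not a zero divisor modulo `a`, then `a ∣ x * y` implies `a ∣ y`. -/
theorem dvd_of_dvd_mul_of_mk_mem_nonZeroDivisors {R : Type*} [CommRing R] {a x y : R}
    (hx : Ideal.Quotient.mk (Ideal.span {a}) x ∈ nonZeroDivisors (R ⧸ Ideal.span {a}))
    (h : a ∣ x * y) : a ∣ y := by
  rw [← Ideal.mem_span_singleton, ← Ideal.Quotient.eq_zero_iff_mem] at h ⊢
  rw [map_mul] at h
  exact (mul_left_mem_nonZeroDivisors_eq_zero_iff hx).mp h

/-- **Annihilator computation for plane curves (Section 5.3).**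
Let `R` be a commutative ring, `γ, δ₁, δ₂, f, f₁, f₂ ∈ R`, and set
`X₁ := γ f₂ + δ₁ f`, `X₂ := −γ f₁ + δ₂ f` and `c := δ₁ f₁ + δ₂ f₂`.  Assume `(X₁, X₂)` is a
regular sequence in `R` (i.e. `X₁` is not a zero divisor in `R` and `X₂` is not a zero
divisor in `R/(X₁)`) and that `f₂` is not a zero divisor in `R/(f)`.  Then for every
`g ∈ R` one has `c g ∈ (X₁, X₂)` iff `g ∈ (γ, f) + (X₁, X₂)`; i.e. the annihilator of the
class of `c` in `𝔹 = R/(X₁, X₂)` is the ideal generated by the classes of `γ` and `f`. -/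
theorem annihilator_of_c (R : Type*) [CommRing R] (γ δ₁ δ₂ f f₁ f₂ X₁ X₂ c : R)
    (hX₁ : X₁ = γ * f₂ + δ₁ * f) (hX₂ : X₂ = -γ * f₁ + δ₂ * f)
    (hc : c = δ₁ * f₁ + δ₂ * f₂)
    (hreg₁ : X₁ ∈ nonZeroDivisors R)
    (hreg₂ : Ideal.Quotient.mk (Ideal.span {X₁}) X₂ ∈
      nonZeroDivisors (R ⧸ Ideal.span ({X₁} : Set R)))
    (hf₂ : Ideal.Quotient.mk (Ideal.span {f}) f₂ ∈ nonZeroDivisors (R ⧸ Ideal.span {f})) :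
    ∀ g : R, c * g ∈ Ideal.span ({X₁, X₂} : Set R) ↔
      g ∈ Ideal.span ({γ, f} : Set R) + Ideal.span ({X₁, X₂} : Set R) := by
  intro g
  rw [Submodule.add_eq_sup, ← Ideal.span_union, Set.insert_union, Set.singleton_union]
  constructor
  · rw [Ideal.mem_span_pair]
    rintro ⟨a, b, hab⟩
    obtain ⟨u, hu⟩ : X₁ ∣ f₂ * g - b * f :=
      dvd_of_dvd_mul_of_mk_mem_nonZeroDivisors hreg₂
        ⟨a * f - f₁ * g, by subst hX₁ hX₂ hc; linear_combination -f * hab⟩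
    obtain ⟨v, hv⟩ : f ∣ g - u * γ :=
      dvd_of_dvd_mul_of_mk_mem_nonZeroDivisors hf₂
        ⟨b + u * δ₁, by subst hX₁; linear_combination hu⟩
    rw [sub_eq_iff_eq_add.mp hv]
    exact add_mem (Ideal.mul_mem_right _ _ (Ideal.subset_span (by simp)))
      (Ideal.mul_mem_left _ _ (Ideal.subset_span (by simp)))
  · intro hg
    simp only [Ideal.mem_span_insert, Ideal.mem_span_singleton'] at hg
    obtain ⟨p, _, ⟨q, _, ⟨r, _, ⟨s, rfl⟩, rfl⟩, rfl⟩, rfl⟩ := hg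
    rw [Ideal.mem_span_pair]
    refine ⟨p * δ₂ + q * f₁ + c * r, -p * δ₁ + q * f₂ + c * s, ?_⟩
    subst hX₁ hX₂ hc
    ring
end

section
/- Identity for c·c_1 on plane curves (Section 5.3): Let f, γ, δ_1, δ_2 be germs at 0 of real analytic functions ℝ² → ℝ. Define the germs X_1 := γ·(∂f/∂y) + δ_1·f, X_2 := −γ·(∂f/∂x) + δ_2·f and c := δ_1·(∂f/∂x) + δ_2·(∂f/∂y). Then the germ c·(∂X_1/∂x + ∂X_2/∂y − c) − c·((∂γ/∂x)(∂f/∂y) − (∂γ/∂y)(∂f/∂x)) lies in the ideal of the ring of real analytic germs at 0 generated by X_1 and X_2; i.e., with c_1 := trace(DX) − c (the coefficient of t in det(1 + tDX)/(1 + tc)), one has c·c_1 = c·det(∂(γ,f)/∂(x,y)) in the quotient ring 𝔹 = ℰ_{ℝ²,0}/(X_1, X_2). -/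
open Filter Topology

/-- The partial derivative `∂g/∂x` of a function `g : ℝ² → ℝ` at a point `z`. -/
noncomputable def pdx (g : ℝ × ℝ → ℝ) (z : ℝ × ℝ) : ℝ := fderiv ℝ g z (1, 0)

/-- The partial derivative `∂g/∂y` of a function `g : ℝ² → ℝ` at a point `z`. -/
noncomputable def pdy (g : ℝ × ℝ → ℝ) (z : ℝ × ℝ) : ℝ := fderiv ℝ g z (0, 1)

/-- The first component `X₁ := γ ∂f/∂y + δ₁ f` of the tangent vector field. -/
noncomputable def X₁ (f γ δ₁ : ℝ × ℝ → ℝ) : ℝ × ℝ → ℝ :=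
  fun w => γ w * pdy f w + δ₁ w * f w

/-- The second component `X₂ := −γ ∂f/∂x + δ₂ f` of the tangent vector field. -/
noncomputable def X₂ (f γ δ₂ : ℝ × ℝ → ℝ) : ℝ × ℝ → ℝ :=
  fun w => -γ w * pdx f w + δ₂ w * f w

/-- The multiplier `c := δ₁ ∂f/∂x + δ₂ ∂f/∂y` in the tangency equation `Xf = cf`. -/
noncomputable def cMul (f δ₁ δ₂ : ℝ × ℝ → ℝ) : ℝ × ℝ → ℝ :=
  fun w => δ₁ w * pdx f w + δ₂ w * pdy f w

/-- The partial derivative `∂g/∂x` of an analytic function is analytic. -/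
theorem AnalyticAt.pdx {g : ℝ × ℝ → ℝ} {z : ℝ × ℝ} (hg : AnalyticAt ℝ g z) :
    AnalyticAt ℝ (pdx g) z :=
  ((ContinuousLinearMap.apply ℝ ℝ ((1, 0) : ℝ × ℝ)).analyticAt _).comp hg.fderiv

/-- The partial derivative `∂g/∂y` of an analytic function is analytic. -/
theorem AnalyticAt.pdy {g : ℝ × ℝ → ℝ} {z : ℝ × ℝ} (hg : AnalyticAt ℝ g z) :
    AnalyticAt ℝ (pdy g) z :=
  ((ContinuousLinearMap.apply ℝ ℝ ((0, 1) : ℝ × ℝ)).analyticAt _).comp hg.fderiv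

/-- Mixed partial derivatives of an analytic function commute. -/
theorem pdx_pdy_comm {g : ℝ × ℝ → ℝ} {z : ℝ × ℝ} (hg : AnalyticAt ℝ g z) :
    pdx (pdy g) z = pdy (pdx g) z := by
  have hd : DifferentiableAt ℝ (fderiv ℝ g) z := hg.fderiv.differentiableAt
  have key (u v : ℝ × ℝ) :
      fderiv ℝ (fun w => fderiv ℝ g w u) z v = fderiv ℝ (fderiv ℝ g) z v u := by
    rw [fderiv_clm_apply hd (differentiableAt_const u)]
    simp
  have hs : IsSymmSndFDerivAt ℝ g z :=
    (hg.contDiffAt (n := 2)).isSymmSndFDerivAt (by simp)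
  exact (key _ _).trans ((hs _ _).trans (key _ _).symm)

/-- The divergence of `(X₁, X₂)` is `det(∂(γ,f)/∂(x,y)) + c + f div δ`. -/
theorem pdx_X₁_add_pdy_X₂ {f γ δ₁ δ₂ : ℝ × ℝ → ℝ} {z : ℝ × ℝ}
    (hf : AnalyticAt ℝ f z) (hγ : AnalyticAt ℝ γ z)
    (hδ₁ : AnalyticAt ℝ δ₁ z) (hδ₂ : AnalyticAt ℝ δ₂ z) :
    pdx (X₁ f γ δ₁) z + pdy (X₂ f γ δ₂) z =
      (pdx γ z * pdy f z - pdy γ z * pdx f z) + cMul f δ₁ δ₂ z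
        + f z * (pdx δ₁ z + pdy δ₂ z) := by
  have hf' := hf.differentiableAt.hasFDerivAt
  have hγ' := hγ.differentiableAt.hasFDerivAt
  have h₁ : HasFDerivAt (X₁ f γ δ₁) _ z :=
    (hγ'.mul hf.pdy.differentiableAt.hasFDerivAt).add
      (hδ₁.differentiableAt.hasFDerivAt.mul hf')
  have h₂ : HasFDerivAt (X₂ f γ δ₂) _ z :=
    (hγ'.neg.mul hf.pdx.differentiableAt.hasFDerivAt).add
      (hδ₂.differentiableAt.hasFDerivAt.mul hf')
  have hs := pdx_pdy_comm hf
  have e₁ : pdx (X₁ f γ δ₁) z = γ z * pdx (pdy f) z + pdy f z * pdx γ z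
      + (δ₁ z * pdx f z + f z * pdx δ₁ z) := by
    rw [pdx, h₁.fderiv]
    rfl
  have e₂ : pdy (X₂ f γ δ₂) z = -γ z * pdy (pdx f) z + pdx f z * -pdy γ z
      + (δ₂ z * pdy f z + f z * pdy δ₂ z) := by
    rw [pdy, h₂.fderiv]
    rfl
  rw [e₁, e₂, hs, cMul]
  ring

/-- **Identity for `c · c₁` on plane curves (Section 5.3).**
Let `f, γ, δ₁, δ₂` be real analytic germs at `0 ∈ ℝ²`, and define
`X₁ := γ ∂f/∂y + δ₁ f`, `X₂ := −γ ∂f/∂x + δ₂ f`, `c := δ₁ ∂f/∂x + δ₂ ∂f/∂y`.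
Then the germ `c (∂X₁/∂x + ∂X₂/∂y − c) − c (∂γ/∂x ∂f/∂y − ∂γ/∂y ∂f/∂x)` lies in the ideal
of the ring of real analytic germs at `0` generated by `X₁` and `X₂`; i.e. with
`c₁ := trace DX − c`, one has `c c₁ = c det(∂(γ,f)/∂(x,y))` in `𝔹 = ℰ_{ℝ²,0}/(X₁, X₂)`. -/
theorem c_mul_c1_identity (f γ δ₁ δ₂ : ℝ × ℝ → ℝ)
    (hf : AnalyticAt ℝ f 0) (hγ : AnalyticAt ℝ γ 0)
    (hδ₁ : AnalyticAt ℝ δ₁ 0) (hδ₂ : AnalyticAt ℝ δ₂ 0) :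
    ∃ a b : ℝ × ℝ → ℝ, AnalyticAt ℝ a 0 ∧ AnalyticAt ℝ b 0 ∧
      ∀ᶠ z in 𝓝 (0 : ℝ × ℝ),
        cMul f δ₁ δ₂ z * (pdx (X₁ f γ δ₁) z + pdy (X₂ f γ δ₂) z - cMul f δ₁ δ₂ z)
          - cMul f δ₁ δ₂ z * (pdx γ z * pdy f z - pdy γ z * pdx f z)
          = a z * X₁ f γ δ₁ z + b z * X₂ f γ δ₂ z := by
  refine ⟨fun z => pdx f z * (pdx δ₁ z + pdy δ₂ z), fun z => pdy f z * (pdx δ₁ z + pdy δ₂ z),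
    hf.pdx.mul (hδ₁.pdx.add hδ₂.pdy), hf.pdy.mul (hδ₁.pdx.add hδ₂.pdy), ?_⟩
  filter_upwards [hf.eventually_analyticAt, hγ.eventually_analyticAt,
    hδ₁.eventually_analyticAt, hδ₂.eventually_analyticAt] with z hfz hγz hδ₁z hδ₂z
  rw [pdx_X₁_add_pdy_X₂ hfz hγz hδ₁z hδ₂z]
  simp only [cMul, X₁, X₂]
  ring
end

section
/- Dimension computations for the family D_k (Section 4.4): Let k ≥ 4 and m ≥ 3 be integers. In the formal power series ring ℂ[[x,y]] consider f := x²y + y^{k−1}, X_1 := (k−2)x^{m+1}, and DF := ∂f/∂y = x² + (k−1)y^{k−2}. Let 𝔅_0 := ℂ[[x,y]]/(f, X_1) and let 𝒞_0 := 𝔅_0/Ann_{𝔅_0}(DF) be the quotient of 𝔅_0 by the annihilator of the class of DF. Then dim_ℂ 𝔅_0 = (k−1)(m+1), dim_ℂ 𝔅_0/(DF) = 2(k−1), and dim_ℂ 𝒞_0 = (k−1)(m−1). -/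
set_option synthInstance.maxHeartbeats 1000000

/-- The power series `x` in `ℂ[[x,y]]`. -/
noncomputable def psX : MvPowerSeries (Fin 2) ℂ := MvPowerSeries.X 0

/-- The power series `y` in `ℂ[[x,y]]`. -/
noncomputable def psY : MvPowerSeries (Fin 2) ℂ := MvPowerSeries.X 1

/-- The `D_k` singularity `f = x²y + y^(k−1)`. -/
noncomputable def fDk (k : ℕ) : MvPowerSeries (Fin 2) ℂ := psX ^ 2 * psY + psY ^ (k - 1)

/-- The first component `X₁ = (k−2) x^(m+1)` of the tangent vector field. -/
noncomputable def X1Dk (k m : ℕ) : MvPowerSeries (Fin 2) ℂ :=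
  ((k : MvPowerSeries (Fin 2) ℂ) - 2) * psX ^ (m + 1)

/-- The minor `DF = ∂f/∂y = x² + (k−1) y^(k−2)`. -/
noncomputable def DFDk (k : ℕ) : MvPowerSeries (Fin 2) ℂ :=
  psX ^ 2 + ((k : MvPowerSeries (Fin 2) ℂ) - 1) * psY ^ (k - 2)

/-- The algebra `𝔅₀ = ℂ[[x,y]]/(f, X₁)`. -/
noncomputable abbrev B0Dk (k m : ℕ) :=
  MvPowerSeries (Fin 2) ℂ ⧸ Ideal.span ({fDk k, X1Dk k m} : Set (MvPowerSeries (Fin 2) ℂ))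

/-- The class of `DF` in `𝔅₀`. -/
noncomputable def DFclass (k m : ℕ) : B0Dk k m :=
  Ideal.Quotient.mk _ (DFDk k)

open MvPowerSeries in
/-- Distinct variables of a power series ring form a regular sequence. -/
lemma MvPowerSeries.X_dvd_of_dvd_X_mul {σ R : Type*} [CommSemiring R] {i j : σ} (hij : i ≠ j)
    {q : MvPowerSeries σ R} (h : (X i : MvPowerSeries σ R) ∣ X j * q) :
    (X i : MvPowerSeries σ R) ∣ q := by
  classical
  rw [X_dvd_iff] at h ⊢
  intro n hn
  have := h (Finsupp.single j 1 + n) (by simp [hn, hij.symm])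
  rwa [X_def, coeff_add_monomial_mul, one_mul] at this

open MvPowerSeries in
lemma MvPowerSeries.X_dvd_of_dvd_X_pow_add_mul {σ R : Type*} [CommRing R] {i j : σ} (hij : i ≠ j)
    (d : ℕ) (h : MvPowerSeries σ R) {q : MvPowerSeries σ R}
    (hq : (X i : MvPowerSeries σ R) ∣ (X j ^ d + X i * h) * q) :
    (X i : MvPowerSeries σ R) ∣ q := by
  rw [add_mul, mul_assoc, dvd_add_left (dvd_mul_right _ _)] at hq
  induction d with
  | zero => simpa using hq
  | succ d ih => exact ih (X_dvd_of_dvd_X_mul hij (by rwa [pow_succ', mul_assoc] at hq))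

/-- If `a, g` is a regular sequence, then the length of the quotient by `(aⁿ, g)` is linear
in `n`. -/
lemma Module.length_quotient_span_pow_pair (K : Type*) {R : Type*} [Field K] [CommRing R]
    [Algebra K R] {a g : R} (ha : a ∈ nonZeroDivisors R) (hg : ∀ q, a ∣ g * q → a ∣ q) (n : ℕ) :
    Module.length K (R ⧸ Ideal.span {a ^ n, g}) =
      n * Module.length K (R ⧸ Ideal.span {a, g}) := by
  induction n with
  | zero =>
    have : Ideal.span {a ^ 0, g} = ⊤ := Ideal.eq_top_of_isUnit_mem _
      (Ideal.subset_span (Set.mem_insert _ _)) (by simp)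
    have : Subsingleton (R ⧸ Ideal.span {a ^ 0, g}) := Ideal.Quotient.subsingleton_iff.2 this
    simp [Module.length_eq_zero]
  | succ n ih =>
    have hle : Ideal.span {a ^ (n + 1), g} ≤ Ideal.span {a, g} := by
      rw [Ideal.span_le, Set.insert_subset_iff, Set.singleton_subset_iff]
      exact ⟨Ideal.pow_mem_of_mem _ (Ideal.subset_span (by simp)) _ n.succ_pos,
        Ideal.subset_span (by simp)⟩
    have hmul : Ideal.span {a ^ n, g} ≤
        Submodule.comap (LinearMap.mulLeft R a) (Ideal.span {a ^ (n + 1), g}) := by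
      rw [Ideal.span_le, Set.insert_subset_iff, Set.singleton_subset_iff]
      exact ⟨Ideal.subset_span (Set.mem_insert_iff.2 (.inl (pow_succ' a n).symm)),
        Ideal.mul_mem_left _ a (Ideal.subset_span (by simp))⟩
    let φ := (Submodule.mapQ _ _ (LinearMap.mulLeft R a) hmul).restrictScalars K
    let ψ := (Submodule.factor hle).restrictScalars K
    have hφ : Function.Injective φ := by
      rw [injective_iff_map_eq_zero]
      intro u hu
      obtain ⟨u, rfl⟩ := Submodule.Quotient.mk_surjective _ u
      have hu : a * u ∈ Ideal.span {a ^ (n + 1), g} := (Submodule.Quotient.mk_eq_zero _).1 hu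
      obtain ⟨p, q, h⟩ := Ideal.mem_span_pair.1 hu
      obtain ⟨r, rfl⟩ := hg q ⟨u - p * a ^ n, by linear_combination h⟩
      refine (Submodule.Quotient.mk_eq_zero _).2 (Ideal.mem_span_pair.2 ⟨p, r, ?_⟩)
      exact (mul_cancel_left_mem_nonZeroDivisors ha).1 (by linear_combination h)
    have hψ : Function.Surjective ψ := Submodule.factor_surjective hle
    have hex : Function.Exact φ ψ := by
      intro v
      obtain ⟨v, rfl⟩ := Submodule.Quotient.mk_surjective _ v
      refine Iff.trans (b := v ∈ Ideal.span {a, g}) (Submodule.Quotient.mk_eq_zero _) ⟨?_, ?_⟩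
      · intro hv
        obtain ⟨p, q, rfl⟩ := Ideal.mem_span_pair.1 hv
        refine ⟨Submodule.Quotient.mk p, (Submodule.Quotient.eq _).2 ?_⟩
        refine Ideal.mem_span_pair.2 ⟨0, -q, ?_⟩
        simp only [LinearMap.mulLeft_apply]
        ring
      · rintro ⟨u, hu⟩
        obtain ⟨u, rfl⟩ := Submodule.Quotient.mk_surjective _ u
        have hu : a * u - v ∈ Ideal.span {a ^ (n + 1), g} := (Submodule.Quotient.eq _).1 hu
        rw [← sub_sub_self (a * u) v]
        exact sub_mem (Ideal.mul_mem_right _ _ (Ideal.subset_span (by simp))) (hle hu)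
    rw [Module.length_eq_add_of_exact φ ψ hφ hψ hex, ih]
    push_cast
    ring

open MvPowerSeries in
lemma MvPowerSeries.span_X_zero_X_one (K : Type*) [CommRing K] :
    Ideal.span {(X 0 : MvPowerSeries (Fin 2) K), X 1} =
      RingHom.ker (constantCoeff (σ := Fin 2) (R := K)) := by
  classical
  apply le_antisymm
  · rw [Ideal.span_le, Set.insert_subset_iff, Set.singleton_subset_iff]
    simp [RingHom.mem_ker]
  · intro p hp
    let r : MvPowerSeries (Fin 2) K := fun n => if n 0 = 0 then coeff n p else 0
    have hr (n) : coeff n r = if n 0 = 0 then coeff n p else 0 := rfl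
    have h0 : (X 0 : MvPowerSeries (Fin 2) K) ∣ p - r := by
      rw [X_dvd_iff]
      intro n hn
      simp [hr, hn]
    have h1 : (X 1 : MvPowerSeries (Fin 2) K) ∣ r := by
      rw [X_dvd_iff]
      intro n hn
      rw [hr]
      split_ifs with h
      · have : n = 0 := by
          ext i
          fin_cases i <;> assumption
        rw [this]
        exact hp
      · rfl
    obtain ⟨u, hu⟩ := h0
    obtain ⟨v, hv⟩ := h1
    exact Ideal.mem_span_pair.2 ⟨u, v, by linear_combination -hu - hv⟩

open MvPowerSeries in
lemma MvPowerSeries.length_quotient_span_X_pair (K : Type*) [Field K] {i j : Fin 2} (hij : i ≠ j) :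
    Module.length K (MvPowerSeries (Fin 2) K ⧸
      Ideal.span {(X i : MvPowerSeries (Fin 2) K), X j}) = 1 := by
  have h : Ideal.span {(X i : MvPowerSeries (Fin 2) K), X j} =
      RingHom.ker (constantCoeff (σ := Fin 2) (R := K)) := by
    rw [← span_X_zero_X_one]
    fin_cases i <;> fin_cases j <;> first | rfl | exact Ideal.span_pair_comm | simp at hij
  let c : MvPowerSeries (Fin 2) K →ₗ[K] K := coeff 0
  have hc : Function.Surjective c := fun z => ⟨C z, by simp [c]⟩
  let e := (Submodule.Quotient.restrictScalarsEquiv K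
    (Ideal.span {(X i : MvPowerSeries (Fin 2) K), X j})).symm ≪≫ₗ
    Submodule.quotEquivOfEq _ (LinearMap.ker c) (by
      ext p
      rw [Submodule.restrictScalars_mem, h]
      rfl) ≪≫ₗ c.quotKerEquivOfSurjective hc
  rw [e.length_eq, Module.length_eq_one]

open MvPowerSeries in
lemma MvPowerSeries.length_quotient_span_X_pow_pair (K : Type*) [Field K] {i j : Fin 2}
    (hij : i ≠ j) (n d : ℕ) (h : MvPowerSeries (Fin 2) K) :
    Module.length K (MvPowerSeries (Fin 2) K ⧸
      Ideal.span {(X i : MvPowerSeries (Fin 2) K) ^ n, X j ^ d + X i * h}) = n * d := by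
  have hX (s : Fin 2) : (X s : MvPowerSeries (Fin 2) K) ∈ nonZeroDivisors _ :=
    X_mem_nonzeroDivisors
  rw [Module.length_quotient_span_pow_pair K (hX i)
    (fun q => X_dvd_of_dvd_X_pow_add_mul hij d h) n, Ideal.span_pair_comm,
    Ideal.span_pair_add_right_mul, Module.length_quotient_span_pow_pair K (hX j)
    (fun q => X_dvd_of_dvd_X_mul hij.symm) d, length_quotient_span_X_pair K hij.symm, mul_one]

lemma Module.finrank_eq_of_length_eq {K V : Type*} [Field K] [AddCommGroup V] [Module K V] {n : ℕ}
    (h : Module.length K V = n) : Module.finrank K V = n := by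
  rw [Module.length_eq_rank] at h
  rw [Module.finrank, ← Cardinal.toNat_toENat, h, ENat.toNat_natCast]

lemma Module.length_quotient_torsionOf_add (K : Type*) {B : Type*} [Field K] [CommRing B]
    [Algebra K B] (b : B) :
    Module.length K (B ⧸ Ideal.torsionOf B B b) + Module.length K (B ⧸ Ideal.span {b}) =
      Module.length K B := by
  let e := (Ideal.quotTorsionOfEquivSpanSingleton B B b).restrictScalars K
  let S : Submodule B B := Ideal.span {b}
  rw [e.length_eq]
  refine (Module.length_eq_add_of_exact (S.subtype.restrictScalars K) (S.mkQ.restrictScalars K)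
    S.injective_subtype S.mkQ_surjective (LinearMap.exact_subtype_mkQ S)).symm

lemma span_fDk_X1Dk {k : ℕ} (hk : 4 ≤ k) (m : ℕ) :
    Ideal.span {fDk k, X1Dk k m} =
      Ideal.span {psX ^ (m + 1), psY ^ (k - 1) + psX * (psX * psY)} := by
  have hu : IsUnit ((k : MvPowerSeries (Fin 2) ℂ) - 2) := by
    have h : (k : ℂ) - 2 ≠ 0 := by
      rw [sub_ne_zero]
      exact_mod_cast (by omega : k ≠ 2)
    have hC := (IsUnit.mk0 _ h).map (MvPowerSeries.C (σ := Fin 2) (R := ℂ))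
    rwa [map_sub, map_natCast, map_ofNat] at hC
  have hf : fDk k = psY ^ (k - 1) + psX * (psX * psY) := by
    rw [fDk]
    ring
  rw [Ideal.span_insert, X1Dk, Ideal.span_singleton_mul_left_unit hu, ← Ideal.span_insert, hf,
    Ideal.span_pair_comm]

lemma span_fDk_X1Dk_sup_span_DFDk {k m : ℕ} (hk : 4 ≤ k) (hm : 3 ≤ m) :
    Ideal.span {fDk k, X1Dk k m} ⊔ Ideal.span {DFDk k} =
      Ideal.span {psY ^ (k - 1),
        psX ^ 2 + psY * (((k : MvPowerSeries (Fin 2) ℂ) - 1) * psY ^ (k - 3))} := by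
  obtain ⟨n, rfl⟩ := Nat.exists_eq_add_of_le' hk
  obtain ⟨l, rfl⟩ := Nat.exists_eq_add_of_le' hm
  have hD : DFDk (n + 4) = psX ^ 2 + psY *
      ((((n + 4 : ℕ) : MvPowerSeries (Fin 2) ℂ) - 1) * psY ^ (n + 4 - 3)) := by
    simp only [DFDk, show n + 4 - 2 = n + 2 by omega,
      show n + 4 - 3 = n + 1 by omega]
    ring
  rw [← hD]
  have hu : IsUnit ((n : MvPowerSeries (Fin 2) ℂ) + 2) := by
    have h : (n : ℂ) + 2 ≠ 0 := by exact_mod_cast (by omega : n + 2 ≠ 0)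
    have hC := (IsUnit.mk0 _ h).map (MvPowerSeries.C (σ := Fin 2) (R := ℂ))
    rwa [map_add, map_natCast, map_ofNat] at hC
  apply le_antisymm
  · rw [sup_le_iff, Ideal.span_le, Ideal.span_le, Set.insert_subset_iff,
      Set.singleton_subset_iff, Set.singleton_subset_iff]
    refine ⟨⟨?_, ?_⟩, Ideal.subset_span (by simp)⟩
    · refine Ideal.mem_span_pair.2 ⟨-(n + 2), psY, ?_⟩
      simp only [fDk, DFDk, show n + 4 - 1 = n + 3 by omega, show n + 4 - 2 = n + 2 by omega]
      push_cast
      ring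
    · refine Ideal.mem_span_pair.2 ⟨(n + 2) * psX ^ l * (n + 3) ^ 2 * psY ^ (n + 1),
        (n + 2) * psX ^ l * (psX ^ 2 - (n + 3) * psY ^ (n + 2)), ?_⟩
      simp only [X1Dk, DFDk, show n + 4 - 1 = n + 3 by omega, show n + 4 - 2 = n + 2 by omega]
      push_cast
      ring
  · rw [Ideal.span_le, Set.insert_subset_iff, Set.singleton_subset_iff]
    have hDF : DFDk (n + 4) ∈
        Ideal.span {fDk (n + 4), X1Dk (n + 4) (l + 3)} ⊔ Ideal.span {DFDk (n + 4)} :=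
      Ideal.mem_sup_right (Ideal.mem_span_singleton_self _)
    refine ⟨(Ideal.unit_mul_mem_iff_mem _ hu).1 ?_, hDF⟩
    have key : ((n : MvPowerSeries (Fin 2) ℂ) + 2) * psY ^ (n + 4 - 1) =
        psY * DFDk (n + 4) - fDk (n + 4) := by
      simp only [fDk, DFDk, show n + 4 - 1 = n + 3 by omega, show n + 4 - 2 = n + 2 by omega]
      push_cast
      ring
    rw [key]
    exact sub_mem (Ideal.mul_mem_left _ _ hDF)
      (Ideal.mem_sup_left (Ideal.subset_span (by simp)))

lemma length_B0Dk {k : ℕ} (hk : 4 ≤ k) (m : ℕ) :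
    Module.length ℂ (B0Dk k m) = ((k - 1) * (m + 1) : ℕ) := by
  change Module.length ℂ (MvPowerSeries (Fin 2) ℂ ⧸ Ideal.span {fDk k, X1Dk k m}) = _
  rw [span_fDk_X1Dk hk m]
  refine (MvPowerSeries.length_quotient_span_X_pow_pair ℂ (by decide : (0 : Fin 2) ≠ 1)
    (m + 1) (k - 1) _).trans ?_
  rw [Nat.mul_comm, Nat.cast_mul]

lemma length_B0Dk_quotient_span_DFclass {k m : ℕ} (hk : 4 ≤ k) (hm : 3 ≤ m) :
    Module.length ℂ (B0Dk k m ⧸ Ideal.span ({DFclass k m} : Set (B0Dk k m))) =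
      (2 * (k - 1) : ℕ) := by
  have hmap : (Ideal.span {DFDk k}).map
      (Ideal.Quotient.mkₐ ℂ (Ideal.span {fDk k, X1Dk k m})) = Ideal.span {DFclass k m} := by
    rw [Ideal.map_span, Set.image_singleton]
    rfl
  rw [← hmap, (DoubleQuot.quotQuotEquivQuotSupₐ ℂ _ _).toLinearEquiv.length_eq,
    span_fDk_X1Dk_sup_span_DFDk hk hm]
  refine (MvPowerSeries.length_quotient_span_X_pow_pair ℂ (by decide : (1 : Fin 2) ≠ 0)
    (k - 1) 2 _).trans ?_
  rw [Nat.mul_comm, Nat.cast_mul]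

/-- **Dimension computations for the family `D_k` (Section 4.4).**
Let `k ≥ 4`, `m ≥ 3`.  In `ℂ[[x,y]]` consider `f := x²y + y^(k−1)`,
`X₁ := (k−2)x^(m+1)` and `DF := ∂f/∂y = x² + (k−1)y^(k−2)`.  Let
`𝔅₀ := ℂ[[x,y]]/(f, X₁)` and `𝒞₀ := 𝔅₀/Ann_{𝔅₀}(DF)`.  Then
`dim_ℂ 𝔅₀ = (k−1)(m+1)`, `dim_ℂ 𝔅₀/(DF) = 2(k−1)` and `dim_ℂ 𝒞₀ = (k−1)(m−1)`. -/
theorem dk_family_dimensions (k m : ℕ) (hk : 4 ≤ k) (hm : 3 ≤ m) :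
    Module.finrank ℂ (B0Dk k m) = (k - 1) * (m + 1) ∧
    Module.finrank ℂ (B0Dk k m ⧸ Ideal.span ({DFclass k m} : Set (B0Dk k m)))
      = 2 * (k - 1) ∧
    Module.finrank ℂ (B0Dk k m ⧸ Ideal.torsionOf (B0Dk k m) (B0Dk k m) (DFclass k m))
      = (k - 1) * (m - 1) := by
  have h₁ := length_B0Dk hk m
  have h₂ := length_B0Dk_quotient_span_DFclass hk hm
  refine ⟨Module.finrank_eq_of_length_eq h₁, Module.finrank_eq_of_length_eq h₂,
    Module.finrank_eq_of_length_eq ?_⟩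
  have h := Module.length_quotient_torsionOf_add ℂ (DFclass k m)
  have hsum : (k - 1) * (m - 1) + 2 * (k - 1) = (k - 1) * (m + 1) := by
    rw [mul_comm 2, ← mul_add, show m - 1 + 2 = m + 1 by omega]
  rw [h₁, h₂, ← hsum, Nat.cast_add] at h
  exact WithTop.add_right_cancel (ENat.natCast_ne_top _) h
end
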